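/- Let μ be a Borel probability measure on a compact interval 𝕀 ⊂ ℝ of positive length having no atoms (μ({x}) = 0 for all x ∈ 𝕀), and let n ∈ ℕ. Then min_{y∈Ξ_n, q∈Π_n} d_K(μ, δ_y^q) = min_{x∈Ξ_n} d_K(μ, δ_x^{u_n}) = 1/(2n), and δ_x^p with x ∈ Ξ_n, p ∈ Π_n is a best d_K-approximation of μ (i.e. minimizes d_K(μ, ·) over measures with at most n atoms) if and only if it is a best uniform d_K-approximation of μ (i.e. p = u_n and x minimizes y ↦ d_K(μ, δ_y^{u_n}) over Ξ_n). -/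

import Mathlib

open MeasureTheory Filter Set

noncomputable section

namespace BenfordApprox

/-- Right-hand limit `f₊` of a nondecreasing `f : ℝ → ℝ̄`, at an extended-real point. -/
def fplus (f : ℝ → EReal) (a : EReal) : EReal := sInf (f '' {x : ℝ | a < (x : EReal)})

/-- Left-hand limit `f₋` of a nondecreasing `f : ℝ → ℝ̄`, at an extended-real point. -/
def fminus (f : ℝ → EReal) (a : EReal) : EReal := sSup (f '' {x : ℝ | (x : EReal) < a})

/-- The (upper) inverse function `f⁻¹(t) = sup {x : f x ≤ t}` (with `sup ∅ = ⊥`). -/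
def upperInv (f : ℝ → EReal) (t : ℝ) : EReal :=
  sSup ((fun x : ℝ => (x : EReal)) '' {x : ℝ | f x ≤ (t : EReal)})

/-- The upper inverse, for an extended-real argument. -/
def upperInvE (f : ℝ → EReal) (t : EReal) : EReal :=
  sSup ((fun x : ℝ => (x : EReal)) '' {x : ℝ | f x ≤ t})

/-- Lévy-type distance `d_L(f,g)` between nondecreasing functions `f g : ℝ → ℝ̄`. -/
def dLfun (f g : ℝ → EReal) : EReal :=
  sInf ((fun y : ℝ => (y : EReal)) ''
    {y : ℝ | 0 ≤ y ∧ ∀ x : ℝ, f (x - y) - (y : EReal) ≤ g x ∧ g x ≤ f (x + y) + (y : EReal)})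

/-- The auxiliary function `ℓ_{f,I}`; it depends on `I` only through `lo = inf I`, `hi = sup I`. -/
def ell (f : ℝ → EReal) (lo hi : EReal) (x : ℝ) : ℝ :=
  sInf {y : ℝ | 0 ≤ y ∧ fminus f (hi - (y : EReal)) - (y : EReal) ≤ (x : EReal) ∧
    (x : EReal) ≤ fplus f (lo + (y : EReal)) + (y : EReal)}

/-- The minimal value `ℓ*_{f,I} = min {y ≥ 0 : f₋(sup I − y) − y ≤ f₊(inf I + y) + y}`. -/
def ellStar (f : ℝ → EReal) (lo hi : EReal) : ℝ :=
  sInf {y : ℝ | 0 ≤ y ∧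
    fminus f (hi - (y : EReal)) - (y : EReal) ≤ fplus f (lo + (y : EReal)) + (y : EReal)}

/-- Distribution function `F_μ(t) = μ {y ∈ 𝕀 : y ≤ t}` of `μ`, where `𝕀 = [A,B]`. -/
def cdf (μ : Measure ℝ) (A B : ℝ) (t : ℝ) : ℝ := (μ (Icc A B ∩ Iic t)).toReal

/-- `F_μ` evaluated at an extended-real point (so `F_μ(−∞) = 0`, `F_μ(+∞) = 1`). -/
def cdfE (μ : Measure ℝ) (A B : ℝ) (a : EReal) : ℝ :=
  (μ (Icc A B ∩ {y : ℝ | (y : EReal) ≤ a})).toReal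

/-- Left limit `F_{μ−}` at an extended-real point (so `F_{μ−}(−∞) = 0`, `F_{μ−}(+∞) = 1`). -/
def cdfL (μ : Measure ℝ) (A B : ℝ) (a : EReal) : ℝ :=
  sSup ((cdf μ A B) '' {t : ℝ | (t : EReal) < a})

/-- Left limit `F_{μ−}` at a real point. -/
def cdfm (μ : Measure ℝ) (A B : ℝ) (t : ℝ) : ℝ := sSup ((cdf μ A B) '' Iio t)

/-- The (upper) quantile function `F_μ⁻¹` of `μ` on `𝕀 = [A,B]`, extended monotonically to `ℝ`. -/
def quant (μ : Measure ℝ) (A B : ℝ) (t : ℝ) : ℝ :=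
  if t < (μ {A}).toReal ∨ t < 0 then A
  else sSup {y ∈ Icc A B | cdf μ A B y ≤ t}

/-- Left limit `F⁻¹_{μ−}` of the quantile function. -/
def quantm (μ : Measure ℝ) (A B : ℝ) (t : ℝ) : ℝ := sSup ((quant μ A B) '' Iio t)

/-- `F_μ` as a function into the extended reals. -/
def cdfEReal (μ : Measure ℝ) (A B : ℝ) : ℝ → EReal := fun t => ((cdf μ A B t : ℝ) : EReal)

/-- `F_μ⁻¹` as a function into the extended reals. -/
def quantEReal (μ : Measure ℝ) (A B : ℝ) : ℝ → EReal := fun t => ((quant μ A B t : ℝ) : EReal)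

/-- The finitely supported measure `δ_x^p = Σ_j p_j δ_{x_j}`. -/
def discr (n : ℕ) (x p : Fin n → ℝ) : Measure ℝ :=
  ∑ j : Fin n, ENNReal.ofReal (p j) • Measure.dirac (x j)

/-- `p ∈ Π_n`: a probability vector. -/
def IsPi (n : ℕ) (p : Fin n → ℝ) : Prop := (∀ j, 0 ≤ p j) ∧ ∑ j, p j = 1

/-- `x ∈ Ξ_n`: a nondecreasing vector of locations in `𝕀 = [A,B]`. -/
def IsXi (A B : ℝ) (n : ℕ) (x : Fin n → ℝ) : Prop := (∀ j, x j ∈ Icc A B) ∧ Monotone x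

/-- The uniform weight vector `u_n = (1/n, …, 1/n)`. -/
def unif (n : ℕ) : Fin n → ℝ := fun _ => 1 / (n : ℝ)

/-- Partial sums `P_i = Σ_{j<i} p_j` (so `P_0 = 0`, `P_n = 1`). -/
def psum (n : ℕ) (p : Fin n → ℝ) (i : ℕ) : ℝ := ∑ j : Fin n, if (j : ℕ) < i then p j else 0

/-- Locations extended by `x_0 = −∞`, `x_{n+1} = +∞`; here `extPts n x j` is the paper's `x_j`. -/
def extPts (n : ℕ) (x : Fin n → ℝ) : ℕ → EReal := fun j =>
  if hj : j = 0 then ⊥ else if h : j ≤ n then ((x ⟨j - 1, by omega⟩ : ℝ) : EReal) else ⊤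

/-- `xcoord n x j` is the paper's `x_{j+1}` (0-based access). -/
def xcoord (n : ℕ) (x : Fin n → ℝ) (j : ℕ) : ℝ := if h : j < n then x ⟨j, h⟩ else 0

/-- The normalizing constant `ω = max{1, λ(𝕀)}/λ(𝕀)` for `𝕀 = [A,B]`. -/
def omegaI (A B : ℝ) : ℝ := max 1 (B - A) / (B - A)

/-- Lévy distance between Borel measures on `𝕀 = [A,B]`. -/
def dLevy (A B : ℝ) (μ ν : Measure ℝ) : ℝ :=
  omegaI A B * sInf {y : ℝ | 0 ≤ y ∧
    ∀ t : ℝ, cdf μ A B (t - y) - y ≤ cdf ν A B t ∧ cdf ν A B t ≤ cdf μ A B (t + y) + y}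

/-- Kolmogorov (uniform) distance between Borel measures on `𝕀 = [A,B]`. -/
def dKol (A B : ℝ) (μ ν : Measure ℝ) : ℝ :=
  sSup (Set.range fun t : ℝ => |cdf μ A B t - cdf ν A B t|)

/-- `L¹`-Kantorovich distance between Borel measures on `𝕀 = [A,B]`. -/
def dKant1 (A B : ℝ) (μ ν : Measure ℝ) : ℝ :=
  (B - A)⁻¹ * ∫ y in Ioo (0 : ℝ) 1, |quant μ A B y - quant ν A B y|

/-- `L^r`-Kantorovich distance between Borel measures on `𝕀 = [A,B]`. -/
def dKant (A B r : ℝ) (μ ν : Measure ℝ) : ℝ :=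
  (B - A)⁻¹ * (∫ y in Ioo (0 : ℝ) 1, |quant μ A B y - quant ν A B y| ^ r) ^ (1 / r)

/-- The Benford measure `β_b` on `[1,b]`: the law of `b^U` with `U` uniform on `[0,1)`. -/
def benford (b : ℝ) : Measure ℝ := (volume.restrict (Ico (0 : ℝ) 1)).map (fun t : ℝ => b ^ t)

/-- The map `T_{f,a}(x) = f₊(f⁻¹(x+a) + 2a) + a`. -/
def Tmap (f : ℝ → EReal) (a : ℝ) : EReal → EReal :=
  fun x => fplus f (upperInvE f (x + (a : EReal)) + ((2 * a : ℝ) : EReal)) + (a : EReal)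

/-- The map `S_{f,a}(x) = f₊(f⁻¹(x+a)) + a`. -/
def Smap (f : ℝ → EReal) (a : ℝ) : EReal → EReal :=
  fun x => fplus f (upperInvE f (x + (a : EReal))) + (a : EReal)

/-- `L_•^{•,n} = min {a ≥ 0 : T_{F_μ,a}^{[n]}(0) ≥ 1}`. -/
def LBB (μ : Measure ℝ) (A B : ℝ) (n : ℕ) : ℝ :=
  sInf {a : ℝ | 0 ≤ a ∧ (1 : EReal) ≤ (Tmap (cdfEReal μ A B) a)^[n] ((0 : ℝ) : EReal)}

/-- `K_•^{•,n} = min {a ≥ 0 : S_{F_μ,a}^{[n]}(0) ≥ 1}`. -/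
def KBB (μ : Measure ℝ) (A B : ℝ) (n : ℕ) : ℝ :=
  sInf {a : ℝ | 0 ≤ a ∧ (1 : EReal) ≤ (Smap (cdfEReal μ A B) a)^[n] ((0 : ℝ) : EReal)}

/-- A measure carried by `[A,B]` has the same distribution function on `[A,B]` as on `ℝ`. -/
lemma cdf_eq_cdf (A B : ℝ) (μ : Measure ℝ) [IsProbabilityMeasure μ] (hμ : μ (Icc A B) = 1)
    (t : ℝ) : cdf μ A B t = ProbabilityTheory.cdf μ t := by
  rw [ProbabilityTheory.cdf_eq_real, Measure.real, cdf]
  congr 1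
  exact Measure.measure_inter_eq_of_ae ((mem_ae_iff_prob_eq_one measurableSet_Icc).2 hμ)

lemma continuous_cdf_of_nonatomic (A B : ℝ) (μ : Measure ℝ) [IsProbabilityMeasure μ]
    (hμ : μ (Icc A B) = 1) (hna : ∀ t : ℝ, μ {t} = 0) : Continuous (cdf μ A B) := by
  rw [show cdf μ A B = ProbabilityTheory.cdf μ from funext (cdf_eq_cdf A B μ hμ)]
  refine continuous_iff_continuousAt.2 fun t => ?_
  have hmono := ProbabilityTheory.monotone_cdf μ
  rw [hmono.continuousAt_iff_leftLim_eq_rightLim, StieltjesFunction.rightLim_eq]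
  have h := (ProbabilityTheory.cdf μ).measure_singleton t
  rw [ProbabilityTheory.measure_cdf, hna, eq_comm, ENNReal.ofReal_eq_zero] at h
  exact le_antisymm (hmono.leftLim_le le_rfl) (by linarith)

lemma cdf_mem_Icc (A B : ℝ) (μ : Measure ℝ) [IsProbabilityMeasure μ] (t : ℝ) :
    cdf μ A B t ∈ Icc (0 : ℝ) 1 :=
  ⟨ENNReal.toReal_nonneg, measureReal_le_one⟩

lemma cdf_mono (A B : ℝ) (μ : Measure ℝ) [IsProbabilityMeasure μ] : Monotone (cdf μ A B) :=
  fun _ _ hst => measureReal_mono (inter_subset_inter_right _ (Iic_subset_Iic.2 hst))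

lemma isProbabilityMeasure_discr {n : ℕ} (x : Fin n → ℝ) {p : Fin n → ℝ} (hp : IsPi n p) :
    IsProbabilityMeasure (discr n x p) := by
  constructor
  simp only [discr, Measure.finsetSum_apply, Measure.smul_apply, measure_univ, smul_eq_mul,
    mul_one]
  rw [← ENNReal.ofReal_sum_of_nonneg fun j _ => hp.1 j, hp.2, ENNReal.ofReal_one]

lemma cdf_discr {A B : ℝ} {n : ℕ} {x p : Fin n → ℝ} (hx : IsXi A B n x) (hp : IsPi n p)
    (t : ℝ) : cdf (discr n x p) A B t = ∑ j, if x j ≤ t then p j else 0 := by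
  rw [cdf, discr, Measure.finsetSum_apply, ENNReal.toReal_sum]
  · refine Finset.sum_congr rfl fun j _ => ?_
    have hj := hx.1 j
    by_cases h : x j ≤ t <;>
      simp [h, hj.1, hj.2, hp.1 j, indicator]
  · intro j _
    exact ENNReal.mul_ne_top ENNReal.ofReal_ne_top (measure_ne_top _ _)

lemma abs_cdf_sub_le_dKol (A B : ℝ) (μ ν : Measure ℝ) [IsProbabilityMeasure μ]
    [IsProbabilityMeasure ν] (t : ℝ) : |cdf μ A B t - cdf ν A B t| ≤ dKol A B μ ν := by
  refine le_csSup ⟨1, ?_⟩ (mem_range_self t)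
  rintro _ ⟨s, rfl⟩
  have h₁ := cdf_mem_Icc A B μ s
  have h₂ := cdf_mem_Icc A B ν s
  exact abs_le.2 ⟨by linarith [h₁.1, h₂.2], by linarith [h₁.2, h₂.1]⟩

/-- Every weight of a finitely supported measure is at most twice its Kolmogorov distance to a
non-atomic measure. -/
lemma weight_le_two_mul_dKol {A B : ℝ} {μ : Measure ℝ} [IsProbabilityMeasure μ]
    (hμ : μ (Icc A B) = 1) (hna : ∀ t : ℝ, μ {t} = 0) {n : ℕ} {x p : Fin n → ℝ}
    (hx : IsXi A B n x) (hp : IsPi n p) (j : Fin n) :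
    p j ≤ 2 * dKol A B μ (discr n x p) := by
  have := isProbabilityMeasure_discr x hp
  have hcont := continuous_cdf_of_nonatomic A B μ hμ hna
  set d := dKol A B μ (discr n x p)
  have hle : ∀ t < x j, p j ≤ cdf μ A B (x j) - cdf μ A B t + 2 * d := by
    intro t ht
    have h₁ := abs_le.1 (abs_cdf_sub_le_dKol A B μ (discr n x p) (x j))
    have h₂ := abs_le.1 (abs_cdf_sub_le_dKol A B μ (discr n x p) t)
    have hjump : p j ≤ cdf (discr n x p) A B (x j) - cdf (discr n x p) A B t := by
      rw [cdf_discr hx hp, cdf_discr hx hp, ← Finset.sum_sub_distrib]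
      calc p j = (if x j ≤ x j then p j else 0) - (if x j ≤ t then p j else 0) := by
            simp [ht.not_ge]
        _ ≤ _ := Finset.single_le_sum
            (f := fun i => (if x i ≤ x j then p i else 0) - (if x i ≤ t then p i else 0))
            (fun i _ => ?_) (Finset.mem_univ j)
      have := hp.1 i
      split_ifs <;> linarith
    linarith [h₁.1, h₂.2]
  have hlim : Tendsto (fun t => cdf μ A B (x j) - cdf μ A B t + 2 * d)
      (nhdsWithin (x j) (Iio (x j))) (nhds (2 * d)) := by
    have h : Continuous fun t => cdf μ A B (x j) - cdf μ A B t + 2 * d := by fun_prop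
    simpa using (h.tendsto (x j)).mono_left nhdsWithin_le_nhds
  exact ge_of_tendsto hlim (eventually_nhdsWithin_of_forall hle)

lemma isPi_unif {n : ℕ} (hn : 0 < n) : IsPi n (unif n) := by
  refine ⟨fun j => by unfold unif; positivity, ?_⟩
  simp only [unif, Finset.sum_const, Finset.card_univ, Fintype.card_fin, nsmul_eq_mul]
  field_simp

lemma one_div_le_dKol {A B : ℝ} {μ : Measure ℝ} [IsProbabilityMeasure μ]
    (hμ : μ (Icc A B) = 1) (hna : ∀ t : ℝ, μ {t} = 0) {n : ℕ} (hn : 0 < n)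
    {x p : Fin n → ℝ} (hx : IsXi A B n x) (hp : IsPi n p) :
    1 / (2 * (n : ℝ)) ≤ dKol A B μ (discr n x p) := by
  have h := Finset.sum_le_sum fun j (_ : j ∈ Finset.univ) =>
    weight_le_two_mul_dKol hμ hna hx hp j
  rw [hp.2] at h
  simp only [Finset.sum_const, Finset.card_univ, Fintype.card_fin, nsmul_eq_mul] at h
  rw [div_le_iff₀ (by positivity)]
  linarith

lemma eq_unif_of_dKol_le {A B : ℝ} {μ : Measure ℝ} [IsProbabilityMeasure μ]
    (hμ : μ (Icc A B) = 1) (hna : ∀ t : ℝ, μ {t} = 0) {n : ℕ} (hn : 0 < n)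
    {x p : Fin n → ℝ} (hx : IsXi A B n x) (hp : IsPi n p)
    (hd : dKol A B μ (discr n x p) ≤ 1 / (2 * (n : ℝ))) : p = unif n := by
  have hle : ∀ j ∈ Finset.univ, p j ≤ unif n j := by
    intro j _
    have h : unif n j = 2 * (1 / (2 * (n : ℝ))) := by
      unfold unif
      field_simp
    linarith [weight_le_two_mul_dKol hμ hna hx hp j]
  have h := (Finset.sum_eq_sum_iff_of_le hle).1 (hp.2.trans (isPi_unif hn).2.symm)
  exact funext fun j => h j (Finset.mem_univ j)

/-- The quantiles of order `(2j+1)/(2n)` carry a uniform approximation at distance `1/(2n)`. -/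
lemma exists_dKol_unif_le {A B : ℝ} (hAB : A < B) {μ : Measure ℝ} [IsProbabilityMeasure μ]
    (hμ : μ (Icc A B) = 1) (hna : ∀ t : ℝ, μ {t} = 0) {n : ℕ} (hn : 0 < n) :
    ∃ y : Fin n → ℝ, IsXi A B n y ∧ dKol A B μ (discr n y (unif n)) ≤ 1 / (2 * (n : ℝ)) := by
  have hn' : (0 : ℝ) < n := by exact_mod_cast hn
  have hmono := cdf_mono A B μ
  have hA : cdf μ A B A = 0 := by
    have : Icc A B ∩ Iic A = {A} := by
      ext t
      simp only [mem_inter_iff, mem_Icc, mem_Iic, mem_singleton_iff]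
      constructor
      · rintro ⟨⟨h₁, _⟩, h₂⟩
        exact le_antisymm h₂ h₁
      · rintro rfl
        exact ⟨⟨le_rfl, hAB.le⟩, le_rfl⟩
    simp [cdf, this, hna]
  have hB : cdf μ A B B = 1 := by
    have : Icc A B ∩ Iic B = Icc A B := inter_eq_left.2 Icc_subset_Iic_self
    simp [cdf, this, hμ]
  have hq : ∀ j : Fin n, ∃ y ∈ Icc A B, cdf μ A B y = (2 * (j : ℕ) + 1) / (2 * n) := by
    intro j
    have hj : ((j : ℕ) : ℝ) + 1 ≤ n := by exact_mod_cast j.isLt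
    refine intermediate_value_Icc hAB.le
      (continuous_cdf_of_nonatomic A B μ hμ hna).continuousOn ?_
    rw [hA, hB]
    refine ⟨by positivity, ?_⟩
    rw [div_le_one (by positivity)]
    linarith
  choose y hyI hy using hq
  have hymono : Monotone y := by
    intro i j hij
    rcases hij.eq_or_lt with rfl | hlt
    · exact le_rfl
    refine (hmono.reflect_lt ?_).le
    rw [hy, hy]
    have : ((i : ℕ) : ℝ) < (j : ℕ) := by exact_mod_cast hlt
    gcongr
  refine ⟨y, ⟨hyI, hymono⟩, csSup_le (range_nonempty _) ?_⟩
  rintro _ ⟨t, rfl⟩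
  dsimp only
  obtain ⟨k, hkn, hk⟩ : ∃ k ≤ n, ∀ j : Fin n, y j ≤ t ↔ (j : ℕ) < k := by
    classical
    have hex : ∃ k, ∀ j : Fin n, y j ≤ t → (j : ℕ) < k := ⟨n, fun j _ => j.isLt⟩
    refine ⟨Nat.find hex, Nat.find_min' hex fun j _ => j.isLt,
      fun j => ⟨Nat.find_spec hex j, fun hj => ?_⟩⟩
    have := Nat.find_min hex hj
    push Not at this
    obtain ⟨i, hi, hji⟩ := this
    exact (hymono hji).trans hi
  have hG : cdf (discr n y (unif n)) A B t = k / n := by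
    rw [cdf_discr ⟨hyI, hymono⟩ (isPi_unif hn)]
    simp only [hk, unif]
    rw [← Finset.sum_filter, Finset.sum_const, Fin.card_filter_val_lt, min_eq_right hkn,
      nsmul_eq_mul, mul_one_div]
  have hF := cdf_mem_Icc A B μ t
  have hlow : (2 * k - 1) / (2 * n) ≤ cdf μ A B t := by
    rcases Nat.eq_zero_or_pos k with rfl | hpos
    · refine le_trans (div_nonpos_of_nonpos_of_nonneg ?_ (by positivity)) hF.1
      norm_num
    · have h := hmono ((hk ⟨k - 1, by omega⟩).2 (Nat.sub_one_lt_of_lt hpos))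
      rw [hy] at h
      refine le_trans (le_of_eq ?_) h
      push_cast [Nat.cast_sub (show 1 ≤ k from hpos)]
      ring
  have hupp : cdf μ A B t ≤ (2 * k + 1) / (2 * n) := by
    rcases hkn.eq_or_lt with rfl | hlt
    · refine hF.2.trans ?_
      rw [le_div_iff₀ (by positivity)]
      linarith
    · have h : t ≤ y ⟨k, hlt⟩ := by
        by_contra! hcon
        exact lt_irrefl _ ((hk ⟨k, hlt⟩).1 hcon.le)
      simpa [hy] using hmono h
  rw [hG, abs_le]
  have h₁ : (2 * k - 1) / (2 * n) = (k : ℝ) / n - 1 / (2 * n) := by field_simp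
  have h₂ : (2 * k + 1) / (2 * n) = (k : ℝ) / n + 1 / (2 * n) := by field_simp
  constructor <;> linarith

/-- Cor. 5.7: for a non-atomic `μ`, the minimal Kolmogorov distance over
measures with at most `n` atoms equals the minimal distance over uniform measures, namely
`1/(2n)`, and best approximations coincide with best uniform approximations. -/
theorem best_dKol_nonatomic (A B : ℝ) (hAB : A < B) (μ : Measure ℝ) [IsProbabilityMeasure μ]
    (hμ : μ (Icc A B) = 1) (hna : ∀ t : ℝ, μ {t} = 0) (n : ℕ) (hn : 0 < n) :
    IsLeast {c : ℝ | ∃ y q : Fin n → ℝ, IsXi A B n y ∧ IsPi n q ∧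
        c = dKol A B μ (discr n y q)} (1 / (2 * (n : ℝ))) ∧
    IsLeast {c : ℝ | ∃ y : Fin n → ℝ, IsXi A B n y ∧
        c = dKol A B μ (discr n y (unif n))} (1 / (2 * (n : ℝ))) ∧
    ∀ x p : Fin n → ℝ, IsXi A B n x → IsPi n p →
      ((∀ y q : Fin n → ℝ, IsXi A B n y → IsPi n q →
          dKol A B μ (discr n x p) ≤ dKol A B μ (discr n y q)) ↔
        (p = unif n ∧ ∀ y : Fin n → ℝ, IsXi A B n y →
          dKol A B μ (discr n x (unif n)) ≤ dKol A B μ (discr n y (unif n)))) := by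
  obtain ⟨z, hz, hzd⟩ := exists_dKol_unif_le hAB hμ hna hn
  have hu := isPi_unif hn
  have hzeq : 1 / (2 * (n : ℝ)) = dKol A B μ (discr n z (unif n)) :=
    le_antisymm (one_div_le_dKol hμ hna hn hz hu) hzd
  refine ⟨⟨⟨z, unif n, hz, hu, hzeq⟩, ?_⟩, ⟨⟨z, hz, hzeq⟩, ?_⟩, fun x p hx hp => ⟨fun h => ?_, ?_⟩⟩
  · rintro _ ⟨y, q, hy, hq, rfl⟩
    exact one_div_le_dKol hμ hna hn hy hq
  · rintro _ ⟨y, hy, rfl⟩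
    exact one_div_le_dKol hμ hna hn hy hu
  · obtain rfl := eq_unif_of_dKol_le hμ hna hn hx hp ((h z _ hz hu).trans hzd)
    exact ⟨rfl, fun y hy => h y _ hy hu⟩
  · rintro ⟨rfl, h⟩ y q hy hq
    exact ((h z hz).trans hzd).trans (one_div_le_dKol hμ hna hn hy hq)

end BenfordApprox
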